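/- For every numerical set H with H ≠ ℕ, one has L(T(H)) = L(H) − 1. -/

import Mathlib

open scoped Classical

/-- A numerical set: a subset of ℕ containing 0 with finite complement. -/
def NumericalSet (H : Set ℕ) : Prop := 0 ∈ H ∧ Hᶜ.Finite

/-- A numerical semigroup: a numerical set closed under addition. -/
def NumericalSemigroup (S : Set ℕ) : Prop :=
  NumericalSet S ∧ ∀ a ∈ S, ∀ b ∈ S, a + b ∈ S

/-- Frobenius number: the largest gap. -/
noncomputable def frob (H : Set ℕ) : ℕ := sSup Hᶜ

/-- Genus: the number of gaps. -/
noncomputable def genus (H : Set ℕ) : ℕ := Hᶜ.ncard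

/-- Multiplicity: the smallest nonzero element. -/
noncomputable def mult (H : Set ℕ) : ℕ := sInf {x | x ∈ H ∧ x ≠ 0}

/-- The T-set of a numerical set.  (With truncated subtraction, every `x ≥ frob H`
satisfies `frob H - x = 0`, matching the convention that `F(H) - x` computed in ℤ
is nonpositive, hence not a nonzero element of `H`.) -/
def Tset (H : Set ℕ) : Set ℕ := {x | frob H - x ∉ H ∨ frob H - x = 0}

/-- The associated numerical semigroup of a numerical set. -/
def A (H : Set ℕ) : Set ℕ := {x | ∀ h ∈ H, x + h ∈ H}

/-- `A*`-operation on numerical sets. -/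
def Astar (H : Set ℕ) : Set ℕ := {a | ∀ h ∈ H, h ≠ 0 → a + h ∈ H}

/-- Pseudo-Frobenius numbers of a numerical set. -/
def PF (H : Set ℕ) : Set ℕ := {a | a ∉ H ∧ ∀ h ∈ H, h ≠ 0 → a + h ∈ H}

/-- Type of a numerical set. -/
noncomputable def typ (H : Set ℕ) : ℕ := (PF H).ncard

/-- Almost symmetric: `t(S) = 2 g(S) - F(S)`. -/
def AlmostSymmetric (S : Set ℕ) : Prop :=
  (typ S : ℤ) = 2 * (genus S : ℤ) - (frob S : ℤ)

/-- An ordinary numerical set: `{0} ∪ {x : x > F(H)}`. -/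
def Ordinary (H : Set ℕ) : Prop := H = insert 0 {x : ℕ | frob H < x}

/-- `l(H) = |H ∩ [1, g(H)]|`. -/
noncomputable def lnum (H : Set ℕ) : ℕ := (H ∩ Set.Icc 1 (genus H)).ncard

/-- `L(H)`: `2 l(H)` if `g(H) ∈ H`, and `2 l(H) + 1` otherwise. -/
noncomputable def Lnum (H : Set ℕ) : ℕ :=
  if genus H ∈ H then 2 * lnum H else 2 * lnum H + 1

theorem frob_notMem {H : Set ℕ} (hH : NumericalSet H) (hne : H ≠ Set.univ) : frob H ∉ H :=
  Nat.sSup_mem (Set.nonempty_compl.2 hne) hH.2.bddAbove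

theorem le_frob {H : Set ℕ} (hH : NumericalSet H) {x : ℕ} (hx : x ∉ H) : x ≤ frob H :=
  le_csSup hH.2.bddAbove hx

theorem mem_Tset_of_lt {H : Set ℕ} {x : ℕ} (hx : x < frob H) :
    x ∈ Tset H ↔ frob H - x ∉ H := by
  have : frob H - x ≠ 0 := by omega
  simp [Tset, this]

theorem mem_Tset_of_le {H : Set ℕ} {x : ℕ} (hx : frob H ≤ x) : x ∈ Tset H :=
  Or.inr (Nat.sub_eq_zero_of_le hx)

theorem genus_eq_card {H : Set ℕ} (hH : NumericalSet H) :
    genus H = ((Finset.Icc 1 (frob H)).filter (· ∉ H)).card := by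
  rw [genus, ← Set.ncard_coe_finset]
  congr 1
  ext x
  simp only [Set.mem_compl_iff, Finset.coe_filter, Finset.mem_Icc, Set.mem_ofPred_eq]
  refine ⟨fun hx => ⟨⟨Nat.one_le_iff_ne_zero.2 ?_, le_frob hH hx⟩, hx⟩, And.right⟩
  rintro rfl
  exact hx hH.1

theorem lnum_eq_card (H : Set ℕ) :
    lnum H = ((Finset.Icc 1 (genus H)).filter (· ∈ H)).card := by
  rw [lnum, ← Set.ncard_coe_finset]
  congr 1
  ext x
  simp only [Set.mem_inter_iff, Set.mem_Icc, Finset.coe_filter, Finset.mem_Icc,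
    Set.mem_ofPred_eq, and_comm]

theorem genus_Tset_eq_card (H : Set ℕ) :
    genus (Tset H) = ((Finset.Icc 1 (frob H)).filter (· ∈ H)).card := by
  have himage : (Tset H)ᶜ =
      ((Finset.Icc 1 (frob H)).filter (· ∈ H)).image (frob H - ·) := by
    ext x
    simp only [Set.mem_compl_iff, Finset.coe_image, Finset.coe_filter, Finset.mem_Icc,
      Set.mem_image, Set.mem_ofPred_eq]
    constructor
    · intro hx
      have hlt : x < frob H := lt_of_not_ge fun h => hx (mem_Tset_of_le h)
      rw [mem_Tset_of_lt hlt, not_not] at hx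
      exact ⟨frob H - x, ⟨by omega, hx⟩, by omega⟩
    · rintro ⟨y, ⟨hy, hyH⟩, rfl⟩
      rw [mem_Tset_of_lt (by omega), not_not, Nat.sub_sub_self hy.2]
      exact hyH
  rw [genus, himage, Set.ncard_coe_finset, Finset.card_image_of_injOn]
  intro a ha b hb hab
  simp only [Finset.coe_filter, Finset.mem_Icc, Set.mem_ofPred_eq] at ha hb hab
  omega

theorem genus_Tset_add_genus {H : Set ℕ} (hH : NumericalSet H) :
    genus (Tset H) + genus H = frob H := by
  rw [genus_Tset_eq_card, genus_eq_card hH, Finset.card_filter_add_card_filter_not]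
  simp

theorem genus_pos {H : Set ℕ} (hH : NumericalSet H) (hne : H ≠ Set.univ) : 0 < genus H :=
  (Set.ncard_pos hH.2).2 (Set.nonempty_compl.2 hne)

theorem lnum_Tset_eq_card {H : Set ℕ} (hH : NumericalSet H) (hne : H ≠ Set.univ) :
    lnum (Tset H) = ((Finset.Ico (genus H) (frob H)).filter (· ∉ H)).card := by
  have hsum := genus_Tset_add_genus hH
  have hpos := genus_pos hH hne
  rw [lnum_eq_card]
  refine Finset.card_bij' (fun x _ => frob H - x) (fun y _ => frob H - y) ?_ ?_ ?_ ?_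
  · intro x hx
    simp only [Finset.mem_filter, Finset.mem_Icc, Finset.mem_Ico] at hx ⊢
    exact ⟨by omega, (mem_Tset_of_lt (by omega)).1 hx.2⟩
  · intro y hy
    simp only [Finset.mem_filter, Finset.mem_Icc, Finset.mem_Ico] at hy ⊢
    refine ⟨by omega, (mem_Tset_of_lt (by omega)).2 ?_⟩
    rw [Nat.sub_sub_self hy.1.2.le]
    exact hy.2
  · intro x hx
    simp only [Finset.mem_filter, Finset.mem_Icc] at hx
    omega
  · intro y hy
    simp only [Finset.mem_filter, Finset.mem_Ico] at hy
    omega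

theorem lnum_Tset {H : Set ℕ} (hH : NumericalSet H) (hne : H ≠ Set.univ) :
    lnum (Tset H) = ((Finset.Ico 1 (genus H)).filter (· ∈ H)).card := by
  have hsum := genus_Tset_add_genus hH
  have hpos := genus_pos hH hne
  have hgaps := genus_eq_card hH
  rw [← Finset.Ico_insert_right (by omega), Finset.filter_insert,
    if_pos (frob_notMem hH hne), Finset.card_insert_of_notMem (by simp),
    ← Finset.Ico_union_Ico_eq_Ico (by omega : 1 ≤ genus H) (by omega : genus H ≤ frob H),
    Finset.filter_union, Finset.card_union_of_disjoint (Finset.disjoint_filter_filter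
      (Finset.Ico_disjoint_Ico_consecutive _ _ _)), ← lnum_Tset_eq_card hH hne] at hgaps
  have hsplit := Finset.card_filter_add_card_filter_not (s := Finset.Ico 1 (genus H)) (· ∈ H)
  rw [Nat.card_Ico] at hsplit
  omega

theorem lnum_eq_lnum_Tset_add {H : Set ℕ} (hH : NumericalSet H) (hne : H ≠ Set.univ) :
    lnum H = lnum (Tset H) + if genus H ∈ H then 1 else 0 := by
  rw [lnum_Tset hH hne, lnum_eq_card, ← Finset.Ico_insert_right (genus_pos hH hne),
    Finset.filter_insert]
  split_ifs <;> simp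

theorem genus_Tset_mem_iff {H : Set ℕ} (hH : NumericalSet H) (hne : H ≠ Set.univ) :
    genus (Tset H) ∈ Tset H ↔ genus H ∉ H := by
  have hsum := genus_Tset_add_genus hH
  have hpos := genus_pos hH hne
  rw [mem_Tset_of_lt (by omega), show frob H - genus (Tset H) = genus H by omega]

theorem stmt_15 (H : Set ℕ) (hH : NumericalSet H) (hne : H ≠ Set.univ) :
    Lnum (Tset H) = Lnum H - 1 := by
  have hl := lnum_eq_lnum_Tset_add hH hne
  simp only [Lnum, genus_Tset_mem_iff hH hne]
  split_ifs at hl ⊢ <;> first | contradiction | omega
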